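/- In quasi-set theory Q, for all m-atoms u and v: if u ≡ v then u* ≡ v*; furthermore, for every qset w, if u ∈ w then u* ⊆ w. -/

import Mathlib

/-- A model of the quasi-set theory `Q`: a domain with predicates for m-atoms,
M-atoms and sets, indistinguishability `≡`, membership `∈`, a quasi-cardinal
function, and (Skolemized) term-forming operations, satisfying the axioms of `Q`. -/
structure QST where
  /-- the domain -/
  U : Type
  /-- `m x` : `x` is an m-atom -/
  m : U → Prop
  /-- `Matom x` : `x` is an M-atom -/
  Matom : U → Prop
  /-- `Z x` : `x` is a set -/
  Z : U → Prop
  /-- indistinguishability `≡` -/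
  ind : U → U → Prop
  /-- membership `∈` -/
  mem : U → U → Prop
  /-- the quasi-cardinal (cardinal-valued) -/
  qc : U → Cardinal.{0}
  /-- the empty qset (axiom Q10) -/
  emptyq : U
  /-- the weak pair `[x,y]` (axiom Q12); the weak singleton is `[x] := pair x x` -/
  pair : U → U → U
  /-- binary union (from axiom Q14) -/
  union : U → U → U
  /-- difference `x − y = [t ∈ x : t ∉ y]` (separation, axiom Q13) -/
  diff : U → U → U
  /-- `cls x a` : the equivalence class `[t ∈ x : t ≡ a]` (separation, axiom Q13) -/
  cls : U → U → U
  /-- the power-qset `𝒫 x` (axiom Q15) -/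
  pow : U → U
  /-- `Su u := [s ∈ 𝒫([u]) : u ∈ s]` for an m-atom `u` -/
  Su : U → U
  /-- `star u = u*`, the intersection of all members of `S_u` -/
  star : U → U
  -- Q1–Q3 : `≡` is an equivalence relation
  ind_refl : ∀ x, ind x x
  ind_symm : ∀ x y, ind x y → ind y x
  ind_trans : ∀ x y z, ind x y → ind y z → ind x z
  -- Q4 : substitutivity of extensional identity `=_E` (atomic instances)
  q4_memL : ∀ x y z,
    ((¬(m x ∨ Matom x) ∧ ¬(m y ∨ Matom y) ∧ ∀ w, mem w x ↔ mem w y) ∨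
      (Matom x ∧ Matom y ∧ ∀ w, ¬(m w ∨ Matom w) → (mem x w ↔ mem y w))) →
    mem x z → mem y z
  q4_memR : ∀ x y z,
    ((¬(m x ∨ Matom x) ∧ ¬(m y ∨ Matom y) ∧ ∀ w, mem w x ↔ mem w y) ∨
      (Matom x ∧ Matom y ∧ ∀ w, ¬(m w ∨ Matom w) → (mem x w ↔ mem y w))) →
    mem z x → mem z y
  q4_qc : ∀ x y,
    ((¬(m x ∨ Matom x) ∧ ¬(m y ∨ Matom y) ∧ ∀ w, mem w x ↔ mem w y) ∨
      (Matom x ∧ Matom y ∧ ∀ w, ¬(m w ∨ Matom w) → (mem x w ↔ mem y w))) →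
    qc x = qc y
  -- Q6 : the atoms are empty
  q6 : ∀ x y, mem x y → ¬(m y ∨ Matom y)
  -- Q8 : qsets of classical things are sets and conversely
  q8 : ∀ x, ¬(m x ∨ Matom x) → ((∀ y, mem y x → (Matom y ∨ Z y)) ↔ Z x)
  -- Q9 (m-atom part)
  q9 : ∀ x y, m x → ind x y → m y
  -- Q10 : the empty qset
  emptyq_qset : ¬(m emptyq ∨ Matom emptyq)
  not_mem_emptyq : ∀ y, ¬ mem y emptyq
  -- Q12 : weak pair
  pair_qset : ∀ x y, ¬(m (pair x y) ∨ Matom (pair x y))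
  mem_pair : ∀ x y t, mem t (pair x y) ↔ (ind t x ∨ ind t y)
  -- Q13 : separation instances (difference and ≡-classes)
  diff_qset : ∀ x y, ¬(m (diff x y) ∨ Matom (diff x y))
  mem_diff : ∀ x y, ¬(m x ∨ Matom x) →
    ∀ t, (mem t (diff x y) ↔ (mem t x ∧ ¬ mem t y))
  cls_qset : ∀ x a, ¬(m (cls x a) ∨ Matom (cls x a))
  mem_cls : ∀ x a, ¬(m x ∨ Matom x) →
    ∀ t, (mem t (cls x a) ↔ (mem t x ∧ ind t a))
  -- Q14 : (binary) union
  union_qset : ∀ x y, ¬(m (union x y) ∨ Matom (union x y))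
  mem_union : ∀ x y, ¬(m x ∨ Matom x) → ¬(m y ∨ Matom y) →
    ∀ t, (mem t (union x y) ↔ (mem t x ∨ mem t y))
  -- Q15 : power-qset
  pow_qset : ∀ x, ¬(m (pow x) ∨ Matom (pow x))
  mem_pow : ∀ x, ¬(m x ∨ Matom x) →
    ∀ t, (mem t (pow x) ↔ ∀ z, mem z t → mem z x)
  -- `S_u` and `u*` for m-atoms `u`
  Su_qset : ∀ u, ¬(m (Su u) ∨ Matom (Su u))
  mem_Su : ∀ u, m u → ∀ s, (mem s (Su u) ↔ (mem s (pow (pair u u)) ∧ mem u s))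
  star_qset : ∀ u, ¬(m (star u) ∨ Matom (star u))
  mem_star : ∀ u, m u → ∀ z, (mem z (star u) ↔
    ((∃ t, mem t (Su u) ∧ mem z t) ∧ ∀ s, mem s (Su u) → mem z s))
  -- Q20 : nonempty qsets have nonzero quasi-cardinal
  q20 : ∀ x, ¬(m x ∨ Matom x) → (∃ y, mem y x) → qc x ≠ 0
  -- Q21 : subqsets of every smaller quasi-cardinality exist
  q21 : ∀ x, ¬(m x ∨ Matom x) → ∀ β : Cardinal.{0}, β ≤ qc x →
    ∃ y, ¬(m y ∨ Matom y) ∧ (∀ z, mem z y → mem z x) ∧ qc y = β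
  -- Q24 : quasi-cardinal of a disjoint union
  q24 : ∀ x y, ¬(m x ∨ Matom x) → ¬(m y ∨ Matom y) →
    (∀ w, ¬(mem w x ∧ mem w y)) → qc (union x y) = qc x + qc y
  -- Q26 : weak extensionality
  q26 : ∀ x y, ¬(m x ∨ Matom x) → ¬(m y ∨ Matom y) →
    (∀ a, mem a x → ∃ b, mem b y ∧
      (∀ z t, mem z (cls x a) → mem t (cls y b) → ind z t) ∧
      qc (cls x a) = qc (cls y b)) →
    (∀ b, mem b y → ∃ a, mem a x ∧
      (∀ z t, mem z (cls y b) → mem t (cls x a) → ind z t) ∧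
      qc (cls y b) = qc (cls x a)) →
    ind x y

namespace QST

variable (T : QST)

/-- `Q(x)` : `x` is a qset. -/
def Qset (x : T.U) : Prop := ¬ (T.m x ∨ T.Matom x)

/-- `x ⊆ y`. -/
def subq (x y : T.U) : Prop := ∀ z, T.mem z x → T.mem z y

/-- Extensional identity `x =_E y`. -/
def eqE (x y : T.U) : Prop :=
  (T.Qset x ∧ T.Qset y ∧ ∀ z, T.mem z x ↔ T.mem z y) ∨
  (T.Matom x ∧ T.Matom y ∧ ∀ z, T.Qset z → (T.mem x z ↔ T.mem y z))

/-- `Sim x y` : every element of `x` is indistinguishable from every element of `y`. -/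
def Sim (x y : T.U) : Prop := ∀ z t, T.mem z x → T.mem t y → T.ind z t

/-- `QSim x y` : `Sim x y` and `qc x = qc y`. -/
def QSim (x y : T.U) : Prop := T.Sim x y ∧ T.qc x = T.qc y

/-- `x'` is a strong singleton of `x` : `x' ⊆ [x]` and `qc x' = 1`. -/
def StrongSingleton (x x' : T.U) : Prop :=
  T.Qset x' ∧ T.subq x' (T.pair x x) ∧ T.qc x' = 1

/-- The generalized ordered pair `⟨x,y⟩ := [[x],[x,y]]`. -/
def opair (x y : T.U) : T.U := T.pair (T.pair x x) (T.pair x y)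

/-- A pure qset: all its elements are m-atoms, pairwise indistinguishable. -/
def PureQset (x : T.U) : Prop :=
  T.Qset x ∧ (∀ y, T.mem y x → T.m y) ∧ ∀ y z, T.mem y x → T.mem z x → T.ind y z

end QST

namespace QST

variable (T : QST)

theorem qc_eq_of_mem_iff {x y : T.U} (hx : T.Qset x) (hy : T.Qset y)
    (h : ∀ z, T.mem z x ↔ T.mem z y) : T.qc x = T.qc y :=
  T.q4_qc x y (Or.inl ⟨hx, hy, h⟩)

/-- A qset of quasi-cardinal `1` is nonempty. -/
theorem exists_mem_of_qc_eq_one {x : T.U} (hx : T.Qset x) (h : T.qc x = 1) :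
    ∃ y, T.mem y x := by
  by_contra! hne
  have hadd := T.q24 x x hx hx fun w hw => hne w hw.1
  have hqc : T.qc (T.union x x) = T.qc x :=
    T.qc_eq_of_mem_iff (T.union_qset x x) hx fun z => by rw [T.mem_union x x hx hx, or_self]
  rw [hqc, h] at hadd
  norm_num at hadd

theorem mem_Su_iff {u : T.U} (hu : T.m u) (s : T.U) :
    T.mem s (T.Su u) ↔ (∀ z, T.mem z s → T.ind z u) ∧ T.mem u s := by
  simp only [T.mem_Su u hu, T.mem_pow _ (T.pair_qset u u), T.mem_pair, or_self]

theorem pair_mem_Su {u : T.U} (hu : T.m u) : T.mem (T.pair u u) (T.Su u) := by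
  simp [T.mem_Su_iff hu, T.mem_pair, T.ind_refl]

theorem self_mem_star {u : T.U} (hu : T.m u) : T.mem u (T.star u) := by
  refine (T.mem_star u hu u).2 ⟨⟨_, T.pair_mem_Su hu, ?_⟩, fun s hs => ?_⟩
  · exact ((T.mem_Su_iff hu _).1 (T.pair_mem_Su hu)).2
  · exact ((T.mem_Su_iff hu s).1 hs).2

theorem ind_of_mem_star {u z : T.U} (hu : T.m u) (hz : T.mem z (T.star u)) : T.ind z u :=
  ((T.mem_Su_iff hu _).1 (T.pair_mem_Su hu)).1 z
    (((T.mem_star u hu z).1 hz).2 _ (T.pair_mem_Su hu))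

/-- `u*` is the least qset to which the m-atom `u` belongs. -/
theorem star_subq {u w : T.U} (hu : T.m u) (hw : T.Qset w) (huw : T.mem u w) :
    T.subq (T.star u) w := by
  intro z hz
  have hcls : T.mem (T.cls w u) (T.Su u) := by
    rw [T.mem_Su_iff hu]
    exact ⟨fun t ht => ((T.mem_cls w u hw t).1 ht).2,
      (T.mem_cls w u hw u).2 ⟨huw, T.ind_refl u⟩⟩
  exact ((T.mem_cls w u hw z).1 (((T.mem_star u hu z).1 hz).2 _ hcls)).1

theorem qc_star {u : T.U} (hu : T.m u) : T.qc (T.star u) = 1 := by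
  have hQ : T.Qset (T.star u) := T.star_qset u
  obtain ⟨y, hy, hsub, hy1⟩ := T.q21 _ hQ 1
    (Cardinal.one_le_iff_ne_zero.2 (T.q20 _ hQ ⟨u, T.self_mem_star hu⟩))
  by_cases huy : T.mem u y
  · rw [← hy1]
    exact T.qc_eq_of_mem_iff hQ hy fun z => ⟨T.star_subq hu hy huy z, hsub z⟩
  · obtain ⟨z, hz⟩ := T.exists_mem_of_qc_eq_one hy hy1
    have hdiff : T.mem u (T.diff (T.star u) y) :=
      (T.mem_diff _ y hQ u).2 ⟨T.self_mem_star hu, huy⟩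
    have hzdiff := T.star_subq hu (T.diff_qset _ y) hdiff z (hsub z hz)
    exact absurd hz ((T.mem_diff _ y hQ z).1 hzdiff).2

theorem mem_cls_star {u a : T.U} (hu : T.m u) (ha : T.mem a (T.star u)) (z : T.U) :
    T.mem z (T.cls (T.star u) a) ↔ T.mem z (T.star u) := by
  rw [T.mem_cls _ a (T.star_qset u)]
  exact and_iff_left_of_imp fun hz =>
    T.ind_trans _ _ _ (T.ind_of_mem_star hu hz) (T.ind_symm _ _ (T.ind_of_mem_star hu ha))

theorem QSim_cls_star {u v a b : T.U} (hu : T.m u) (hv : T.m v) (huv : T.ind u v)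
    (ha : T.mem a (T.star u)) (hb : T.mem b (T.star v)) :
    T.QSim (T.cls (T.star u) a) (T.cls (T.star v) b) := by
  refine ⟨fun z t hz ht => ?_, ?_⟩
  · rw [T.mem_cls_star hu ha] at hz
    rw [T.mem_cls_star hv hb] at ht
    exact T.ind_trans _ _ _ (T.ind_of_mem_star hu hz)
      (T.ind_trans _ _ _ huv (T.ind_symm _ _ (T.ind_of_mem_star hv ht)))
  · rw [T.qc_eq_of_mem_iff (T.cls_qset _ a) (T.star_qset u) (T.mem_cls_star hu ha),
      T.qc_eq_of_mem_iff (T.cls_qset _ b) (T.star_qset v) (T.mem_cls_star hv hb),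
      T.qc_star hu, T.qc_star hv]

theorem star_ind_star {u v : T.U} (hu : T.m u) (hv : T.m v) (huv : T.ind u v) :
    T.ind (T.star u) (T.star v) :=
  T.q26 _ _ (T.star_qset u) (T.star_qset v)
    (fun _ ha => ⟨v, T.self_mem_star hv, T.QSim_cls_star hu hv huv ha (T.self_mem_star hv)⟩)
    (fun _ hb => ⟨u, T.self_mem_star hu,
      T.QSim_cls_star hv hu (T.ind_symm _ _ huv) hb (T.self_mem_star hu)⟩)

end QST

/-- In quasi-set theory `Q`, for all m-atoms `u` and `v`: if `u ≡ v` then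
`u* ≡ v*`; furthermore, for every qset `w`, if `u ∈ w` then `u* ⊆ w`. -/
theorem stmt11 (T : QST) (u v : T.U) (hu : T.m u) (hv : T.m v) :
    (T.ind u v → T.ind (T.star u) (T.star v)) ∧
    (∀ w, T.Qset w → T.mem u w → T.subq (T.star u) w) :=
  ⟨T.star_ind_star hu hv, fun _ hw huw => T.star_subq hu hw huw⟩
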